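/- arXiv:1908.09934 — 7 statements merged into one kernel-verified Lean document; each statement's English description precedes it below -/
import Mathlib

section
/- Let X and Y be normed spaces and M ⊆ X × X. Suppose G : M → Y is diagonal-differentiable with respect to the second variable at (x₀, x₀) with diagonal-derivative L₂ : X → Y, and suppose the map F defined by F(x) := G(x, x) (on the set of x with (x,x) ∈ M) is Fréchet differentiable at x₀ with Fréchet derivative DF(x₀). Then the map x ↦ G(x, x₀) is Fréchet differentiable at x₀ with Fréchet derivative DF(x₀) − L₂. -/
open Filter Metric Set
open scoped Topology

/-- If `G` is diagonal-differentiable with respect to the second variable at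
`(x₀, x₀)` with diagonal-derivative `L₂`, and `F x := G x x` is Fréchet differentiable at `x₀`
with derivative `L`, then `x ↦ G x x₀` is Fréchet differentiable at `x₀` with derivative
`L - L₂`. -/
theorem stmt0 {X Y : Type*} [NormedAddCommGroup X] [NormedSpace ℝ X]
    [NormedAddCommGroup Y] [NormedSpace ℝ Y]
    (G : X → X → Y) (x₀ : X) (L₂ L : X →L[ℝ] Y)
    (hdiag : ∀ ε > (0 : ℝ), ∃ δ > (0 : ℝ), ∀ h k : X, ‖k‖ ≤ ‖h‖ → ‖h‖ < δ →
      ‖G (x₀ + k) (x₀ + h) - G (x₀ + k) x₀ - L₂ h‖ ≤ ε * ‖h‖)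
    (hF : HasFDerivAt (fun x => G x x) L x₀) :
    HasFDerivAt (fun x => G x x₀) (L - L₂) x₀ := by
  have hdiag' : (fun h => G (x₀ + h) (x₀ + h) - G (x₀ + h) x₀ - L₂ h) =o[𝓝 0] fun h => h := by
    refine Asymptotics.isLittleO_iff.2 fun ε hε => ?_
    obtain ⟨δ, hδ, H⟩ := hdiag ε hε
    filter_upwards [ball_mem_nhds (0 : X) hδ] with h hh
    exact H h h le_rfl (mem_ball_zero_iff.1 hh)
  rw [hasFDerivAt_iff_isLittleO_nhds_zero] at hF ⊢
  refine (hF.sub hdiag').congr_left fun h => ?_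
  rw [sub_apply]
  abel
end

section
/- Let X₁, X₂, Y be normed spaces, (x₀, y₀) an interior point of U₁ × U₂ ⊆ X₁ × X₂, and G : U₁ × U₂ → Y. Suppose the partial Gateaux derivatives D₂G(x, y) ∈ 𝓛(X₂, Y) with respect to the second variable exist for all (x, y) in a neighborhood of (x₀, y₀), and lim_{(x,y)→(x₀,y₀)} D₂G(x, y) = D₂G(x₀, y₀) =: L in operator norm. Then G is diagonal-differentiable with respect to the second variable at (x₀, y₀) with diagonal-derivative L. -/
open Filter Metric Set
open scoped Topology

/-- If the partial Gateaux derivatives `D₂G (x, y)` with respect to the second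
variable exist for all `(x, y)` in a neighborhood `W` of `(x₀, y₀)` and converge in operator
norm to `L = D₂G (x₀, y₀)` as `(x, y) → (x₀, y₀)`, then `G` is diagonal-differentiable with
respect to the second variable at `(x₀, y₀)` with diagonal-derivative `L`. -/
theorem stmt1 {X₁ X₂ Y : Type*} [NormedAddCommGroup X₁] [NormedSpace ℝ X₁]
    [NormedAddCommGroup X₂] [NormedSpace ℝ X₂]
    [NormedAddCommGroup Y] [NormedSpace ℝ Y]
    (G : X₁ → X₂ → Y) (x₀ : X₁) (y₀ : X₂)
    (D₂G : X₁ → X₂ → (X₂ →L[ℝ] Y)) (L : X₂ →L[ℝ] Y)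
    (W : Set (X₁ × X₂)) (hW : W ∈ 𝓝 (x₀, y₀))
    (hgateaux : ∀ z ∈ W, ∀ h : X₂,
      Tendsto (fun lam : ℝ => lam⁻¹ • (G z.1 (z.2 + lam • h) - G z.1 z.2))
        (𝓝[≠] 0) (𝓝 (D₂G z.1 z.2 h)))
    (hcont : Tendsto (fun z : X₁ × X₂ => D₂G z.1 z.2) (𝓝 (x₀, y₀)) (𝓝 L))
    (hval : D₂G x₀ y₀ = L) :
    ∀ ε > (0 : ℝ), ∃ δ > (0 : ℝ), ∀ h : X₂, ∀ k : X₁, ‖k‖ ≤ ‖h‖ → ‖h‖ < δ →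
      ‖G (x₀ + k) (y₀ + h) - G (x₀ + k) y₀ - L h‖ ≤ ε * ‖h‖ := by
  intro ε hε
  obtain ⟨δ, hδ, hball⟩ := Metric.mem_nhds_iff.1
    (inter_mem hW (hcont (Metric.closedBall_mem_nhds L hε)))
  refine ⟨δ, hδ, fun h k hkh hh => ?_⟩
  have hmem : ∀ t ∈ Icc (0 : ℝ) 1, (x₀ + k, y₀ + t • h) ∈ ball (x₀, y₀) δ := by
    intro t ht
    have hth : ‖t • h‖ ≤ ‖h‖ := by
      rw [norm_smul, Real.norm_of_nonneg ht.1]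
      exact mul_le_of_le_one_left (norm_nonneg h) ht.2
    rw [mem_ball, Prod.dist_eq, max_lt_iff]
    simp only [dist_self_add_left]
    exact ⟨hkh.trans_lt hh, hth.trans_lt hh⟩
  have hderiv : ∀ t ∈ Icc (0 : ℝ) 1,
      HasDerivWithinAt (fun s : ℝ => G (x₀ + k) (y₀ + s • h) - s • L h)
        (D₂G (x₀ + k) (y₀ + t • h) h - L h) (Icc 0 1) t := by
    intro t ht
    have hG : HasDerivAt (fun s : ℝ => G (x₀ + k) (y₀ + s • h))
        (D₂G (x₀ + k) (y₀ + t • h) h) t := by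
      rw [hasDerivAt_iff_tendsto_slope_zero]
      simpa only [add_smul, add_assoc] using hgateaux _ (hball (hmem t ht)).1 h
    have hL : HasDerivAt (fun s : ℝ => s • L h) (L h) t := by
      simpa using (hasDerivAt_id t).smul_const (L h)
    exact (hG.sub hL).hasDerivWithinAt
  have hbound : ∀ t ∈ Ico (0 : ℝ) 1, ‖D₂G (x₀ + k) (y₀ + t • h) h - L h‖ ≤ ε * ‖h‖ := by
    intro t ht
    have hclose : ‖D₂G (x₀ + k) (y₀ + t • h) - L‖ ≤ ε :=
      mem_closedBall_iff_norm.1 (hball (hmem t (Ico_subset_Icc_self ht))).2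
    rw [← sub_apply]
    exact ContinuousLinearMap.le_of_opNorm_le _ hclose h
  have hmvt := norm_image_sub_le_of_norm_deriv_le_segment_01' hderiv hbound
  simpa [sub_right_comm] using hmvt
end

section
/- Let X₁, X₂, Y be normed spaces, (x₀, y₀) an interior point of U₁ × U₂ ⊆ X₁ × X₂, and G : U₁ × U₂ → Y. Suppose there is a neighborhood U₀ ⊆ U₁ of x₀ such that the family of maps G(x, ·), x ∈ U₀, is equidifferentiable at y₀ with derivatives D₂G(x, y₀), i.e. lim_{‖h‖→0} sup_{x∈U₀} ‖G(x, y₀+h) − G(x, y₀) − D₂G(x, y₀)h‖/‖h‖ = 0, and that lim_{x→x₀} D₂G(x, y₀) = D₂G(x₀, y₀) =: L in operator norm. Then G is diagonal-differentiable with respect to the second variable at (x₀, y₀) with diagonal-derivative L. -/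
open Filter Metric Set
open scoped Topology

/-- If the family `G (x, ·)`, `x ∈ U₀`, is equidifferentiable at `y₀` with
derivatives `D₂G x`, and `D₂G x → D₂G x₀ = L` in operator norm as `x → x₀`, then `G` is
diagonal-differentiable with respect to the second variable at `(x₀, y₀)` with
diagonal-derivative `L`. -/
theorem stmt2 {X₁ X₂ Y : Type*} [NormedAddCommGroup X₁] [NormedSpace ℝ X₁]
    [NormedAddCommGroup X₂] [NormedSpace ℝ X₂]
    [NormedAddCommGroup Y] [NormedSpace ℝ Y]
    (G : X₁ → X₂ → Y) (x₀ : X₁) (y₀ : X₂)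
    (D₂G : X₁ → (X₂ →L[ℝ] Y)) (L : X₂ →L[ℝ] Y)
    (U₀ : Set X₁) (hU₀ : U₀ ∈ 𝓝 x₀)
    (hequi : ∀ ε > (0 : ℝ), ∃ δ > (0 : ℝ), ∀ x ∈ U₀, ∀ h : X₂, ‖h‖ < δ →
      ‖G x (y₀ + h) - G x y₀ - D₂G x h‖ ≤ ε * ‖h‖)
    (hcont : Tendsto D₂G (𝓝 x₀) (𝓝 L))
    (hval : D₂G x₀ = L) :
    ∀ ε > (0 : ℝ), ∃ δ > (0 : ℝ), ∀ h : X₂, ∀ k : X₁, ‖k‖ ≤ ‖h‖ → ‖h‖ < δ →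
      ‖G (x₀ + k) (y₀ + h) - G (x₀ + k) y₀ - L h‖ ≤ ε * ‖h‖ := by
  intro ε hε
  obtain ⟨δ₁, hδ₁, hG⟩ := hequi (ε / 2) (half_pos hε)
  obtain ⟨δ₂, hδ₂, hball⟩ := Metric.mem_nhds_iff.1
    (inter_mem hU₀ (hcont (ball_mem_nhds L (half_pos hε))))
  refine ⟨min δ₁ δ₂, lt_min hδ₁ hδ₂, fun h k hk hh => ?_⟩
  have hmem : x₀ + k ∈ ball x₀ δ₂ := by
    rw [mem_ball_iff_norm, add_sub_cancel_left]
    exact hk.trans_lt (hh.trans_le (min_le_right _ _))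
  obtain ⟨hxU, hxL⟩ := hball hmem
  have hD : ‖D₂G (x₀ + k) - L‖ ≤ ε / 2 := (mem_ball_iff_norm.1 hxL).le
  calc ‖G (x₀ + k) (y₀ + h) - G (x₀ + k) y₀ - L h‖
      = ‖(G (x₀ + k) (y₀ + h) - G (x₀ + k) y₀ - D₂G (x₀ + k) h)
          + (D₂G (x₀ + k) - L) h‖ := by
        rw [sub_apply, sub_add_sub_cancel]
    _ ≤ ε / 2 * ‖h‖ + ε / 2 * ‖h‖ :=
        norm_add_le_of_le (hG _ hxU h (hh.trans_le (min_le_left _ _)))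
          ((D₂G (x₀ + k) - L).le_of_opNorm_le hD h)
    _ = ε * ‖h‖ := by ring
end

section
/- Let X and Y be normed spaces, M ⊆ X × X, G : M → Y, and F(x) := G(x, x). If G is diagonal-differentiable with respect to the second variable at some interior point (x₀, x₀) of M with diagonal-derivative L = D₂G(x₀, x₀), then [G(·, x₀)]_{x₀} ≤ [F]_{x₀} + α(L(B₁(0))), where B₁(0) is the open unit ball of X. -/
open Filter Metric Set
open scoped Topology ENNReal

/-- The Hausdorff measure of noncompactness of a set `M`: the infimum of all `ε ∈ [0,∞]`
such that `M` is covered by finitely many open balls of radius `ε`. -/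
noncomputable def hmnc {Y : Type*} [SeminormedAddCommGroup Y] (M : Set Y) : ℝ≥0∞ :=
  sInf {ε : ℝ≥0∞ | ∃ N : Set Y, N.Finite ∧ M ⊆ ⋃ y ∈ N, EMetric.ball y ε}

/-- `[F]_{x₀} := limsup_{r→0⁺} α(F(B_r(x₀)))/r`. -/
noncomputable def mncBracket {X Y : Type*} [SeminormedAddCommGroup X]
    [SeminormedAddCommGroup Y] (F : X → Y) (x₀ : X) : ℝ≥0∞ :=
  Filter.limsup (fun r : ℝ => hmnc (F '' Metric.ball x₀ r) / ENNReal.ofReal r) (𝓝[>] 0)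

open scoped Pointwise

/-- If every point of `S` is within `e` of a difference of points of `A` and `B`, then the
measure of noncompactness of `S` is at most that of `A` plus that of `B` plus `e`. -/
theorem hmnc_le_add_of_edist_sub_le {Y : Type*} [SeminormedAddCommGroup Y] {S A B : Set Y}
    {e : ℝ≥0∞} (he : e ≠ ∞)
    (hS : ∀ s ∈ S, ∃ a ∈ A, ∃ b ∈ B, edist s (a - b) ≤ e) :
    hmnc S ≤ hmnc A + (hmnc B + e) := by
  change hmnc S ≤ sInf _ + (sInf _ + e)
  simp only [sInf_eq_iInf, ENNReal.iInf_add, ENNReal.add_iInf, le_iInf_iff]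
  rintro ε₂ ⟨N₂, hN₂, hB⟩ ε₁ ⟨N₁, hN₁, hA⟩
  refine sInf_le ⟨N₁ - N₂, hN₁.sub hN₂, fun s hs => ?_⟩
  obtain ⟨a, ha, b, hb, hab⟩ := hS s hs
  obtain ⟨n, hn, han⟩ := mem_iUnion₂.1 (hA ha)
  obtain ⟨m, hm, hbm⟩ := mem_iUnion₂.1 (hB hb)
  refine mem_iUnion₂.2 ⟨n - m, sub_mem_sub hn hm, ?_⟩
  have hsub : edist (a - b) (n - m) ≤ edist a n + edist b m := by
    simpa [sub_eq_add_neg] using edist_add_add_le a (-b) n (-m)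
  calc edist s (n - m) ≤ edist s (a - b) + edist (a - b) (n - m) := edist_triangle _ _ _
    _ ≤ e + (edist a n + edist b m) := add_le_add hab hsub
    _ < e + (ε₁ + ε₂) := (ENNReal.add_lt_add_iff_left he).2 (ENNReal.add_lt_add han hbm)
    _ = ε₁ + (ε₂ + e) := by ring

theorem hmnc_smul_le {Y : Type*} [SeminormedAddCommGroup Y] [NormedSpace ℝ Y] (A : Set Y)
    {r : ℝ} (hr : 0 < r) : hmnc (r • A) ≤ ENNReal.ofReal r * hmnc A := by
  have hr₀ : ENNReal.ofReal r ≠ 0 := by simpa using hr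
  rw [mul_comm, ← ENNReal.div_le_iff_le_mul (Or.inl hr₀) (Or.inl ENNReal.ofReal_ne_top)]
  refine le_sInf ?_
  rintro ε ⟨N, hN, hA⟩
  rw [ENNReal.div_le_iff_le_mul (Or.inl hr₀) (Or.inl ENNReal.ofReal_ne_top), mul_comm]
  refine sInf_le ⟨r • N, hN.smul_set, ?_⟩
  rintro _ ⟨a, ha, rfl⟩
  obtain ⟨n, hn, han⟩ := mem_iUnion₂.1 (hA ha)
  refine mem_iUnion₂.2 ⟨r • n, smul_mem_smul_set hn, ?_⟩
  change edist (r • a) (r • n) < _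
  rw [edist_smul₀, ENNReal.smul_def, smul_eq_mul, ← enorm_eq_nnnorm, Real.enorm_of_nonneg hr.le]
  exact (ENNReal.mul_lt_mul_iff_right hr₀ ENNReal.ofReal_ne_top).2 han

/-- If `G` is diagonal-differentiable with respect to the second variable at
`(x₀, x₀)` with diagonal-derivative `L`, and `F x := G x x`, then
`[G(·,x₀)]_{x₀} ≤ [F]_{x₀} + α(L(B₁(0)))`. -/
theorem stmt5 {X Y : Type*} [NormedAddCommGroup X] [NormedSpace ℝ X]
    [NormedAddCommGroup Y] [NormedSpace ℝ Y]
    (G : X → X → Y) (x₀ : X) (L : X →L[ℝ] Y)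
    (hdiag : ∀ ε > (0 : ℝ), ∃ δ > (0 : ℝ), ∀ h k : X, ‖k‖ ≤ ‖h‖ → ‖h‖ < δ →
      ‖G (x₀ + k) (x₀ + h) - G (x₀ + k) x₀ - L h‖ ≤ ε * ‖h‖) :
    mncBracket (fun x => G x x₀) x₀ ≤
      mncBracket (fun x => G x x) x₀ + hmnc (⇑L '' Metric.ball (0 : X) 1) := by
  refine ENNReal.le_of_forall_pos_le_add fun ε hε _ => ?_
  obtain ⟨δ, hδ, hG⟩ := hdiag ε hε
  set c := hmnc (⇑L '' ball (0 : X) 1)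
  have hle : ∀ᶠ r : ℝ in 𝓝[>] 0,
      hmnc ((fun x => G x x₀) '' ball x₀ r) / ENNReal.ofReal r ≤
        hmnc ((fun x => G x x) '' ball x₀ r) / ENNReal.ofReal r + (c + ε) := by
    filter_upwards [Ioo_mem_nhdsGT hδ] with r ⟨hr, hrδ⟩
    have hr₀ : ENNReal.ofReal r ≠ 0 := by simpa using hr
    have hball : hmnc ((fun x => G x x₀) '' ball x₀ r) ≤
        hmnc ((fun x => G x x) '' ball x₀ r) +
          (hmnc (r • (⇑L '' ball (0 : X) 1)) + ENNReal.ofReal (ε * r)) := by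
      refine hmnc_le_add_of_edist_sub_le ENNReal.ofReal_ne_top ?_
      rintro _ ⟨x, hx, rfl⟩
      have hxr : ‖x - x₀‖ < r := by simpa [dist_eq_norm] using hx
      refine ⟨G x x, ⟨x, hx, rfl⟩, L (x - x₀), ?_, ?_⟩
      · refine ⟨L (r⁻¹ • (x - x₀)), ⟨_, ?_, rfl⟩, ?_⟩
        · rw [mem_ball_zero_iff, norm_smul, norm_inv, Real.norm_of_nonneg hr.le,
            inv_mul_lt_iff₀ hr, mul_one]
          exact hxr
        · simp [smul_smul, hr.ne']
      · have h := hG (x - x₀) (x - x₀) le_rfl (hxr.trans hrδ)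
        rw [add_sub_cancel] at h
        rw [edist_dist, dist_comm, dist_eq_norm, sub_right_comm]
        exact ENNReal.ofReal_le_ofReal
          (h.trans (mul_le_mul_of_nonneg_left hxr.le ε.coe_nonneg))
    rw [ENNReal.div_le_iff_le_mul (Or.inl hr₀) (Or.inl ENNReal.ofReal_ne_top), add_mul,
      ENNReal.div_mul_cancel hr₀ ENNReal.ofReal_ne_top, add_mul]
    refine hball.trans (add_le_add le_rfl (add_le_add ?_ ?_))
    · rw [mul_comm]
      exact hmnc_smul_le _ hr
    · rw [ENNReal.ofReal_mul ε.coe_nonneg, ENNReal.ofReal_coe_nnreal]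
  calc mncBracket (fun x => G x x₀) x₀
      ≤ limsup (fun r : ℝ => hmnc ((fun x => G x x) '' ball x₀ r) / ENNReal.ofReal r + (c + ε))
          (𝓝[>] 0) := limsup_le_limsup hle
    _ = mncBracket (fun x => G x x) x₀ + (c + ε) :=
        limsup_add_const _ _ _ (by isBoundedDefault) (by isBoundedDefault)
    _ = mncBracket (fun x => G x x) x₀ + c + ε := (add_assoc _ _ _).symm
end

section
/- Let Ω be a measure space containing no atoms of finite measure, E₁ and E₂ Banach spaces, and 1 ≤ p ≤ q < ∞. Then the pair (L_p(Ω, E₁), L_q(Ω, E₂)) is a weak V-pair: for every x ∈ L_p(Ω, E₁), every y ∈ L_q(Ω, E₂), and every measurable T ⊆ Ω with 1_T · y ≠ 0 in L_q, there are a sequence of measurable sets D_n ⊆ T and a sequence x_n ∈ L_p(Ω, E₁) with x_n = x almost everywhere on D_n, such that 1_{D_n} · y ≠ 0 in L_q, lim_{n→∞} ‖x_n‖_{L_p} = 0, and liminf_{n→∞} sup { ‖x_n‖_{L_p} / ‖y_n‖_{L_q} : y_n ∈ L_q(Ω, E₂), y_n = y almost everywhere on D_n } < ∞. -/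
open MeasureTheory Filter Metric Set
open scoped Topology ENNReal

/-- A measurable set of positive finite measure in a space without atoms of finite measure contains
measurable subsets of arbitrarily small positive measure. -/
theorem exists_measurable_subset_measure_le {Ω : Type*} [MeasurableSpace Ω] {μ : Measure Ω}
    (hatom : ∀ T : Set Ω, MeasurableSet T → 0 < μ T → μ T < ⊤ →
      ∃ D ⊆ T, MeasurableSet D ∧ 0 < μ D ∧ μ D < μ T)
    {A : Set Ω} (hA : MeasurableSet A) (hA0 : 0 < μ A) (hAtop : μ A < ⊤)
    {ε : ℝ≥0∞} (hε : 0 < ε) :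
    ∃ D ⊆ A, MeasurableSet D ∧ 0 < μ D ∧ μ D ≤ ε := by
  have half : ∀ B : Set Ω, MeasurableSet B → 0 < μ B → μ B < ⊤ →
      ∃ D ⊆ B, MeasurableSet D ∧ 0 < μ D ∧ μ D ≤ μ B / 2 := by
    intro B hB hB0 hBtop
    obtain ⟨D, hDB, hD, hD0, hDlt⟩ := hatom B hB hB0 hBtop
    rcases le_total (μ D) (μ B / 2) with h | h
    · exact ⟨D, hDB, hD, hD0, h⟩
    · have hdiff : μ (B \ D) = μ B - μ D :=
        measure_sdiff hDB hD.nullMeasurableSet (hDlt.trans hBtop).ne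
      refine ⟨B \ D, sdiff_subset, hB.diff hD, ?_, ?_⟩
      · rw [hdiff]
        exact tsub_pos_of_lt hDlt
      · rw [hdiff, tsub_le_iff_right]
        calc μ B = μ B / 2 + μ B / 2 := (ENNReal.add_halves _).symm
          _ ≤ μ B / 2 + μ D := by gcongr
  have iter : ∀ n : ℕ, ∃ D ⊆ A, MeasurableSet D ∧ 0 < μ D ∧ μ D ≤ μ A * 2⁻¹ ^ n := by
    intro n
    induction n with
    | zero => exact ⟨A, Subset.rfl, hA, hA0, by simp⟩
    | succ n ih =>
      obtain ⟨B, hBA, hB, hB0, hBle⟩ := ih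
      obtain ⟨D, hDB, hD, hD0, hDle⟩ := half B hB hB0 ((measure_mono hBA).trans_lt hAtop)
      refine ⟨D, hDB.trans hBA, hD, hD0, hDle.trans ?_⟩
      rw [pow_succ, ← mul_assoc, div_eq_mul_inv]
      gcongr
  have hlim : Tendsto (fun n : ℕ => μ A * (2⁻¹ : ℝ≥0∞) ^ n) atTop (𝓝 0) := by
    simpa using ENNReal.Tendsto.const_mul
      (ENNReal.tendsto_pow_atTop_nhds_zero_of_lt_one (ENNReal.inv_lt_one.2 ENNReal.one_lt_two))
      (Or.inr hAtop.ne)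
  obtain ⟨n, hn⟩ := (hlim.eventually_lt_const hε).exists
  obtain ⟨D, hDA, hD, hD0, hDle⟩ := iter n
  exact ⟨D, hDA, hD, hD0, hDle.trans hn.le⟩

/-- If `g ∈ L_q` with `q < ∞` does not vanish a.e. on `T`, then some subset of `T` of positive finite
measure carries both a lower bound on `‖g‖` and an upper bound on `‖f‖`. -/
theorem exists_measurable_subset_norm_bounds {Ω : Type*} [MeasurableSpace Ω] {μ : Measure Ω}
    {E₁ E₂ : Type*} [NormedAddCommGroup E₁] [NormedAddCommGroup E₂] {q : ℝ≥0∞}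
    (hq0 : q ≠ 0) (hq : q ≠ ⊤) {f : Ω → E₁} {g : Ω → E₂} (hf : StronglyMeasurable f)
    (hg : StronglyMeasurable g) (hgq : MemLp g q μ) {T : Set Ω} (hT : MeasurableSet T)
    (hTg : ¬ (T.indicator g =ᵐ[μ] 0)) :
    ∃ A ⊆ T, MeasurableSet A ∧ 0 < μ A ∧ μ A < ⊤ ∧ ∃ c > (0 : ℝ), ∃ M : ℝ,
      ∀ t ∈ A, c ≤ ‖g t‖ ∧ ‖f t‖ ≤ M := by
  let A : ℕ → Set Ω := fun n => T ∩ ({t | 1 / ((n : ℝ) + 1) ≤ ‖g t‖} ∩ {t | ‖f t‖ ≤ n})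
  have hAmeas : ∀ n, MeasurableSet (A n) := fun n =>
    hT.inter ((measurableSet_le measurable_const hg.norm.measurable).inter
      (measurableSet_le hf.norm.measurable measurable_const))
  have hpos : ∃ n, 0 < μ (A n) := by
    by_contra! h
    refine hTg ?_
    have hnull : μ (⋃ n, A n) = 0 := measure_iUnion_null fun n => le_antisymm (h n) zero_le
    filter_upwards [measure_eq_zero_iff_ae_notMem.1 hnull] with t ht
    by_contra hne
    have htT : t ∈ T := by
      by_contra htT
      simp [htT] at hne
    have hgt : 0 < ‖g t‖ := by
      simpa [htT] using hne
    obtain ⟨k, hk⟩ := exists_nat_one_div_lt hgt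
    obtain ⟨m, hm⟩ := exists_nat_ge ‖f t‖
    refine ht (mem_iUnion.2 ⟨max k m, htT, ?_, ?_⟩)
    · refine le_trans (one_div_le_one_div_of_le (by positivity) ?_) hk.le
      gcongr
      exact le_max_left k m
    · exact hm.trans (by exact_mod_cast le_max_right k m)
  obtain ⟨n, hn⟩ := hpos
  have hc : (0 : ℝ) < 1 / ((n : ℝ) + 1) := by positivity
  refine ⟨A n, inter_subset_left, hAmeas n, hn, ?_, _, hc, n, fun t ht => ht.2⟩
  refine lt_of_le_of_lt (measure_mono ?_)
    (hgq.meas_ge_lt_top hq0 hq (ε := (1 / ((n : ℝ) + 1)).toNNReal)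
      (Real.toNNReal_pos.2 hc).ne')
  intro t ht
  exact Real.toNNReal_le_iff_le_coe.2 ht.2.1

/-- If `Ω` has no atoms of finite measure and `1 ≤ p ≤ q < ∞`, then
`(L_p(Ω,E₁), L_q(Ω,E₂))` is a weak V-pair. -/
theorem stmt8 {Ω : Type*} [MeasurableSpace Ω] {μ : Measure Ω}
    {E₁ E₂ : Type*} [NormedAddCommGroup E₁] [CompleteSpace E₁]
    [NormedAddCommGroup E₂] [CompleteSpace E₂]
    (hatom : ∀ T : Set Ω, MeasurableSet T → 0 < μ T → μ T < ⊤ →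
      ∃ D ⊆ T, MeasurableSet D ∧ 0 < μ D ∧ μ D < μ T)
    (p q : ℝ≥0∞) [Fact (1 ≤ p)] [Fact (1 ≤ q)] (hpq : p ≤ q) (hq : q ≠ ⊤)
    (x : Lp E₁ p μ) (y : Lp E₂ q μ) (T : Set Ω) (hT : MeasurableSet T)
    (hTy : ¬ (T.indicator ⇑y =ᵐ[μ] 0)) :
    ∃ (D : ℕ → Set Ω) (xn : ℕ → Lp E₁ p μ),
      (∀ n, MeasurableSet (D n)) ∧ (∀ n, D n ⊆ T) ∧
      (∀ n, ∀ᵐ t ∂μ, t ∈ D n → xn n t = x t) ∧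
      (∀ n, ¬ ((D n).indicator ⇑y =ᵐ[μ] 0)) ∧
      Tendsto (fun n => ‖xn n‖) atTop (𝓝 0) ∧
      Filter.liminf (fun n =>
        ⨆ yn : {z : Lp E₂ q μ // ∀ᵐ t ∂μ, t ∈ D n → z t = y t},
          ENNReal.ofReal ‖xn n‖ / ENNReal.ofReal ‖(yn : Lp E₂ q μ)‖) atTop < ⊤ := by
  have hp0 : p ≠ 0 := (zero_lt_one.trans_le (Fact.out : 1 ≤ p)).ne'
  have hq0 : q ≠ 0 := (zero_lt_one.trans_le (Fact.out : 1 ≤ q)).ne'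
  have hp : p ≠ ⊤ := ne_top_of_le_ne_top hq hpq
  have hexp : q.toReal⁻¹ ≤ p.toReal⁻¹ :=
    inv_anti₀ (ENNReal.toReal_pos hp0 hp) (ENNReal.toReal_mono hq hpq)
  have hp_inv : 0 < p.toReal⁻¹ := inv_pos.2 (ENNReal.toReal_pos hp0 hp)
  obtain ⟨A, hAT, hA, hA0, hAtop, c, hc, M, hAb⟩ := exists_measurable_subset_norm_bounds hq0 hq
    (Lp.stronglyMeasurable x) (Lp.stronglyMeasurable y) (Lp.memLp y) hT hTy
  choose D hDA hD hD0 hDle using fun n : ℕ =>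
    exists_measurable_subset_measure_le hatom hA hA0 hAtop
      (ENNReal.pow_pos (ENNReal.inv_pos.2 ENNReal.ofNat_ne_top : (0 : ℝ≥0∞) < 2⁻¹) n)
  have hDlim : Tendsto (fun n => μ (D n)) atTop (𝓝 0) :=
    tendsto_of_tendsto_of_tendsto_of_le_of_le tendsto_const_nhds
      (ENNReal.tendsto_pow_atTop_nhds_zero_of_lt_one (ENNReal.inv_lt_one.2 ENNReal.one_lt_two))
      (fun _ => zero_le) hDle
  have hD1 : ∀ n, μ (D n) ≤ 1 := fun n =>
    (hDle n).trans (pow_le_one₀ zero_le (ENNReal.inv_le_one.2 ENNReal.one_lt_two.le))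
  have hDtop : ∀ n, μ (D n) ≠ ⊤ := fun n => ((hD1 n).trans_lt ENNReal.one_lt_top).ne
  let xn : ℕ → Lp E₁ p μ := fun n => ((Lp.memLp x).indicator (hD n)).toLp
  have hxn : ∀ n, ENNReal.ofReal ‖xn n‖ ≤ μ (D n) ^ p.toReal⁻¹ * ENNReal.ofReal M := by
    intro n
    rw [ofReal_norm, Lp.enorm_toLp, eLpNorm_indicator_eq_eLpNorm_restrict (hD n)]
    have h := eLpNorm_le_of_ae_bound (p := p)
      (ae_restrict_of_forall_mem (μ := μ) (hD n) fun t ht => (hAb t (hDA n ht)).2)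
    rwa [Measure.restrict_apply_univ] at h
  have hyn : ∀ n (z : Lp E₂ q μ), (∀ᵐ t ∂μ, t ∈ D n → z t = y t) →
      ENNReal.ofReal c * μ (D n) ^ q.toReal⁻¹ ≤ ENNReal.ofReal ‖z‖ := by
    intro n z hz
    rw [ofReal_norm, Lp.enorm_def]
    refine le_trans ?_ (eLpNorm_mono_measure z (Measure.restrict_le_self (s := D n)))
    have hconst : eLpNorm (fun _ : Ω => c) q (μ.restrict (D n)) =
        ENNReal.ofReal c * μ (D n) ^ q.toReal⁻¹ := by
      rw [eLpNorm_const' c hq0 hq, Measure.restrict_apply_univ, Real.enorm_of_nonneg hc.le,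
        one_div]
    rw [← hconst]
    refine eLpNorm_mono_ae ?_
    filter_upwards [(ae_restrict_iff' (hD n)).2 hz, ae_restrict_mem (hD n)] with t ht htD
    rw [ht, Real.norm_of_nonneg hc.le]
    exact (hAb t (hDA n htD)).1
  refine ⟨D, xn, hD, fun n => (hDA n).trans hAT, ?_, ?_, ?_, ?_⟩
  · intro n
    filter_upwards [((Lp.memLp x).indicator (hD n)).coeFn_toLp] with t ht htD
    rw [ht, indicator_of_mem htD]
  · intro n h
    refine (hD0 n).ne' (measure_mono_null (fun t ht => ?_) (ae_iff.1 h))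
    have hpos : 0 < ‖y t‖ := hc.trans_le (hAb t (hDA n ht)).1
    simpa [ht] using hpos
  · have hbound : Tendsto (fun n => μ (D n) ^ p.toReal⁻¹ * ENNReal.ofReal M) atTop (𝓝 0) := by
      have h := ENNReal.Tendsto.mul_const (hDlim.ennrpow_const p.toReal⁻¹)
        (Or.inr (ENNReal.ofReal_ne_top (r := M)))
      simpa [ENNReal.zero_rpow_of_pos hp_inv] using h
    have hlim := tendsto_of_tendsto_of_tendsto_of_le_of_le tendsto_const_nhds hbound
      (fun _ => zero_le) hxn
    simpa [Function.comp_def] using (ENNReal.tendsto_toReal ENNReal.zero_ne_top).comp hlim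
  · have hc' : ENNReal.ofReal c ≠ 0 := (ENNReal.ofReal_pos.2 hc).ne'
    refine lt_of_le_of_lt (liminf_le_liminf (Eventually.of_forall fun n => iSup_le fun z => ?_))
      ((liminf_const (f := atTop (α := ℕ)) (ENNReal.ofReal M / ENNReal.ofReal c)).trans_lt
        (ENNReal.div_lt_top ENNReal.ofReal_ne_top hc'))
    have hpow0 : μ (D n) ^ q.toReal⁻¹ ≠ 0 := (ENNReal.rpow_pos (hD0 n) (hDtop n)).ne'
    have hpowtop : μ (D n) ^ q.toReal⁻¹ ≠ ⊤ :=
      ENNReal.rpow_ne_top_of_nonneg (inv_nonneg.2 ENNReal.toReal_nonneg) (hDtop n)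
    calc ENNReal.ofReal ‖xn n‖ / ENNReal.ofReal ‖(z : Lp E₂ q μ)‖
        ≤ (μ (D n) ^ p.toReal⁻¹ * ENNReal.ofReal M) /
            (ENNReal.ofReal c * μ (D n) ^ q.toReal⁻¹) :=
          ENNReal.div_le_div (hxn n) (hyn n z z.2)
      _ ≤ (ENNReal.ofReal M * μ (D n) ^ q.toReal⁻¹) /
            (ENNReal.ofReal c * μ (D n) ^ q.toReal⁻¹) := by
          rw [mul_comm]
          gcongr ENNReal.ofReal M * ?_ / _
          exact ENNReal.rpow_le_rpow_of_exponent_ge (hD1 n) hexp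
      _ = ENNReal.ofReal M / ENNReal.ofReal c := ENNReal.mul_div_mul_right _ _ hpow0 hpowtop
end

section
/- Let Ω be a measure space containing no atoms of finite measure, E₁ and E₂ Banach spaces, and 1 ≤ p < ∞. Let f : Ω × E₁ → E₂, let U ⊆ L_p(Ω, E₁), and let F : U → L_p(Ω, E₂) satisfy F(x)(t) = f(t, x(t)) for almost all t ∈ Ω for every x ∈ U. If F satisfies a Lipschitz condition with constant L on some neighborhood (intersected with U) of an interior point x₀ of U, then F satisfies the global pointwise Lipschitz condition |F(y₁)(t) − F(y₂)(t)| ≤ L|y₁(t) − y₂(t)| for almost all t ∈ Ω, for every y₁, y₂ ∈ U, with the same constant L. -/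
open MeasureTheory Filter Metric Set
open scoped Topology ENNReal

/-- If every measurable set of positive finite measure can be split, then it has measurable subsets
of arbitrarily small positive measure. -/
theorem exists_measurableSet_subset_measure_pos_le {Ω : Type*} [MeasurableSpace Ω] {μ : Measure Ω}
    (hatom : ∀ T : Set Ω, MeasurableSet T → 0 < μ T → μ T < ⊤ →
      ∃ D ⊆ T, MeasurableSet D ∧ 0 < μ D ∧ μ D < μ T)
    {T : Set Ω} (hT : MeasurableSet T) (hpos : 0 < μ T) (hfin : μ T < ⊤)
    {ε : ℝ≥0∞} (hε : 0 < ε) :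
    ∃ D ⊆ T, MeasurableSet D ∧ 0 < μ D ∧ μ D ≤ ε := by
  have halve : ∀ A : Set Ω, MeasurableSet A → 0 < μ A → μ A < ⊤ →
      ∃ D ⊆ A, MeasurableSet D ∧ 0 < μ D ∧ μ D ≤ μ A / 2 := by
    intro A hA hA0 hAfin
    obtain ⟨D, hDA, hD, hD0, hDlt⟩ := hatom A hA hA0 hAfin
    rcases le_total (μ D) (μ A / 2) with h | h
    · exact ⟨D, hDA, hD, hD0, h⟩
    · have hdiff : μ (A \ D) = μ A - μ D :=
        measure_sdiff hDA hD.nullMeasurableSet (hDlt.trans hAfin).ne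
      refine ⟨A \ D, sdiff_subset, hA.diff hD, ?_, ?_⟩
      · rw [hdiff]
        exact tsub_pos_of_lt hDlt
      · rw [hdiff, tsub_le_iff_right]
        calc μ A = μ A / 2 + μ A / 2 := (ENNReal.add_halves _).symm
          _ ≤ μ A / 2 + μ D := by gcongr
  have iterate : ∀ n : ℕ, ∃ D ⊆ T, MeasurableSet D ∧ 0 < μ D ∧ μ D ≤ μ T * 2⁻¹ ^ n := by
    intro n
    induction n with
    | zero => exact ⟨T, subset_rfl, hT, hpos, by simp⟩
    | succ n ih =>
      obtain ⟨D, hDT, hD, hD0, hDle⟩ := ih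
      obtain ⟨D', hD'D, hD', hD'0, hD'le⟩ :=
        halve D hD hD0 ((measure_mono hDT).trans_lt hfin)
      refine ⟨D', hD'D.trans hDT, hD', hD'0, hD'le.trans ?_⟩
      rw [pow_succ, ← mul_assoc, ENNReal.div_eq_inv_mul, mul_comm]
      gcongr
  have hlim : Tendsto (fun n : ℕ => μ T * 2⁻¹ ^ n) atTop (𝓝 0) := by
    simpa using ENNReal.Tendsto.const_mul
      (ENNReal.tendsto_pow_atTop_nhds_zero_of_lt_one (r := 2⁻¹) (by simp)) (Or.inr hfin.ne)
  obtain ⟨n, hn⟩ := (hlim.eventually (gt_mem_nhds hε)).exists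
  obtain ⟨D, hDT, hD, hD0, hDle⟩ := iterate n
  exact ⟨D, hDT, hD, hD0, hDle.trans hn.le⟩

/-- Strict monotonicity of the `L^p` seminorm for `0 < p < ∞`. -/
theorem eLpNorm_lt_eLpNorm_of_ae_lt {Ω E E' : Type*} [MeasurableSpace Ω] {μ : Measure Ω}
    [NormedAddCommGroup E] [NormedAddCommGroup E'] {p : ℝ≥0∞} (hp0 : p ≠ 0) (hp : p ≠ ⊤)
    (hμ : μ ≠ 0) {g : Ω → E} {h : Ω → E'} (hg : MemLp g p μ) (hh : AEStronglyMeasurable h μ)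
    (hlt : ∀ᵐ t ∂μ, ‖g t‖ < ‖h t‖) : eLpNorm g p μ < eLpNorm h p μ := by
  have hp_pos : 0 < p.toReal := ENNReal.toReal_pos hp0 hp
  rw [eLpNorm_eq_lintegral_rpow_enorm_toReal hp0 hp, eLpNorm_eq_lintegral_rpow_enorm_toReal hp0 hp]
  refine ENNReal.rpow_lt_rpow ?_ (by positivity)
  refine lintegral_strict_mono hμ (hh.enorm.pow_const _)
    (lintegral_rpow_enorm_lt_top_of_eLpNorm_lt_top hp0 hp hg.eLpNorm_lt_top).ne ?_
  filter_upwards [hlt] with t ht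
  refine ENNReal.rpow_lt_rpow ?_ hp_pos
  rw [← ofReal_norm, ← ofReal_norm]
  exact (ENNReal.ofReal_lt_ofReal_iff_of_nonneg (norm_nonneg _)).2 ht

/-- A measurable set of positive measure on which an `L^p` function does not vanish, `0 < p < ∞`,
has a measurable subset of positive finite measure. -/
theorem exists_subset_measure_pos_lt_top_of_memLp {Ω E : Type*} [MeasurableSpace Ω]
    {μ : Measure Ω} [NormedAddCommGroup E] {p : ℝ≥0∞} (hp0 : p ≠ 0) (hp : p ≠ ⊤)
    {g : Ω → E} (hg : MemLp g p μ) (hgm : StronglyMeasurable g)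
    {S : Set Ω} (hS : MeasurableSet S) (hpos : μ S ≠ 0) (hne : ∀ t ∈ S, g t ≠ 0) :
    ∃ T ⊆ S, MeasurableSet T ∧ 0 < μ T ∧ μ T < ⊤ := by
  have hcover : S ⊆ ⋃ n : ℕ, S ∩ {t | 1 / ((n : ℝ) + 1) ≤ ‖g t‖} := by
    intro t ht
    obtain ⟨n, hn⟩ := exists_nat_one_div_lt (norm_pos_iff.2 (hne t ht))
    exact mem_iUnion.2 ⟨n, ht, hn.le⟩
  obtain ⟨n, hn⟩ : ∃ n : ℕ, μ (S ∩ {t | 1 / ((n : ℝ) + 1) ≤ ‖g t‖}) ≠ 0 := by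
    by_contra! h
    exact hpos (measure_mono_null hcover (measure_iUnion_null h))
  refine ⟨_, inter_subset_left,
    hS.inter (measurableSet_le measurable_const hgm.norm.measurable), pos_iff_ne_zero.2 hn, ?_⟩
  refine (measure_mono inter_subset_right).trans_lt ?_
  have h := hg.meas_ge_lt_top hp0 hp (ε := 1 / ((n : NNReal) + 1)) (by positivity)
  refine (measure_mono ?_).trans_lt h
  intro t ht
  simp only [mem_ofPred_eq] at ht ⊢
  norm_cast
  rw [← NNReal.coe_le_coe]
  simpa using ht

/-- The element of `L^p` that agrees with `y` on `D` and with `x` off `D`. -/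
noncomputable def LpPiecewise {Ω E : Type*} [MeasurableSpace Ω] {μ : Measure Ω}
    [NormedAddCommGroup E] {p : ℝ≥0∞} {D : Set Ω} (hD : MeasurableSet D) (x y : Lp E p μ) :
    Lp E p μ :=
  x + ((Lp.memLp (y - x)).indicator hD).toLp _

section LpPiecewise

variable {Ω E : Type*} [MeasurableSpace Ω] {μ : Measure Ω} [NormedAddCommGroup E] {p : ℝ≥0∞}
  {D : Set Ω} (hD : MeasurableSet D) (x y : Lp E p μ)

theorem coeFn_LpPiecewise :
    ∀ᵐ t ∂μ, (t ∈ D → LpPiecewise hD x y t = y t) ∧ (t ∉ D → LpPiecewise hD x y t = x t) := by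
  filter_upwards [Lp.coeFn_add x (((Lp.memLp (y - x)).indicator hD).toLp _),
    ((Lp.memLp (y - x)).indicator hD).coeFn_toLp, Lp.coeFn_sub y x] with t h₁ h₂ h₃
  unfold LpPiecewise
  refine ⟨fun ht => ?_, fun ht => ?_⟩ <;> rw [h₁, Pi.add_apply, h₂]
  · rw [indicator_of_mem ht, h₃, Pi.sub_apply, add_sub_cancel]
  · rw [indicator_of_notMem ht, add_zero]

theorem dist_LpPiecewise_left [Fact (1 ≤ p)] :
    dist (LpPiecewise hD x y) x = (eLpNorm (D.indicator (y - x : Lp E p μ)) p μ).toReal := by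
  rw [dist_eq_norm, LpPiecewise, add_sub_cancel_left, Lp.norm_toLp]

end LpPiecewise

/-- If `Ω` has no atoms of finite measure, `1 ≤ p < ∞`, and the
superposition operator `F(x)(t) = f(t, x(t))` maps `U ⊆ L_p(Ω,E₁)` into `L_p(Ω,E₂)` and
satisfies a Lipschitz condition with constant `L` on some neighborhood (intersected with `U`)
of an interior point `x₀` of `U`, then `F` satisfies the global pointwise Lipschitz condition
`|F(y₁)(t) − F(y₂)(t)| ≤ L |y₁(t) − y₂(t)|` a.e. for all `y₁, y₂ ∈ U`. -/
theorem stmt13 {Ω : Type*} [MeasurableSpace Ω] {μ : Measure Ω}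
    {E₁ E₂ : Type*} [NormedAddCommGroup E₁] [CompleteSpace E₁]
    [NormedAddCommGroup E₂] [CompleteSpace E₂]
    (hatom : ∀ T : Set Ω, MeasurableSet T → 0 < μ T → μ T < ⊤ →
      ∃ D ⊆ T, MeasurableSet D ∧ 0 < μ D ∧ μ D < μ T)
    (p : ℝ≥0∞) [Fact (1 ≤ p)] (hp : p ≠ ⊤)
    (f : Ω → E₁ → E₂) (U : Set (Lp E₁ p μ)) (F : Lp E₁ p μ → Lp E₂ p μ)
    (hF : ∀ x ∈ U, ⇑(F x) =ᵐ[μ] fun t => f t (x t))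
    (x₀ : Lp E₁ p μ) (hx₀ : x₀ ∈ interior U)
    (L : ℝ) (hL : 0 ≤ L)
    (hLip : ∃ V ∈ 𝓝 x₀, ∀ x ∈ V ∩ U, ∀ y ∈ V ∩ U, ‖F x - F y‖ ≤ L * ‖x - y‖) :
    ∀ y₁ ∈ U, ∀ y₂ ∈ U,
      ∀ᵐ t ∂μ, ‖F y₁ t - F y₂ t‖ ≤ L * ‖y₁ t - y₂ t‖ := by
  have hp0 : p ≠ 0 := (zero_lt_one.trans_le (Fact.out : 1 ≤ p)).ne'
  obtain ⟨V, hV, hLip⟩ := hLip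
  obtain ⟨r, hr, hball⟩ := Metric.mem_nhds_iff.1 (inter_mem hV (mem_interior_iff_mem_nhds.1 hx₀))
  intro y₁ hy₁ y₂ hy₂
  set g : Ω → E₂ := fun t => F y₁ t - F y₂ t with hg_def
  set h : Ω → E₁ := fun t => y₁ t - y₂ t
  have hg : MemLp g p μ := (Lp.memLp (F y₁)).sub (Lp.memLp (F y₂))
  have hh : MemLp h p μ := (Lp.memLp y₁).sub (Lp.memLp y₂)
  have hgm : StronglyMeasurable g := (Lp.stronglyMeasurable _).sub (Lp.stronglyMeasurable _)
  have hhm : StronglyMeasurable h := (Lp.stronglyMeasurable _).sub (Lp.stronglyMeasurable _)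
  set S : Set Ω := {t | L * ‖h t‖ < ‖g t‖}
  have hS : MeasurableSet S :=
    measurableSet_lt (hhm.norm.measurable.const_mul L) hgm.norm.measurable
  suffices hS0 : μ S = 0 by
    rw [ae_iff]
    simpa only [not_le] using hS0
  by_contra hSpos
  obtain ⟨T, hTS, hT, hT0, hTfin⟩ := exists_subset_measure_pos_lt_top_of_memLp hp0 hp hg hgm hS
    hSpos fun t ht => norm_pos_iff.1 ((mul_nonneg hL (norm_nonneg _)).trans_lt ht)
  obtain ⟨δ₁, hδ₁, hsmall₁⟩ :=
    (Lp.memLp (y₁ - x₀)).eLpNorm_indicator_le Fact.out hp (half_pos hr)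
  obtain ⟨δ₂, hδ₂, hsmall₂⟩ :=
    (Lp.memLp (y₂ - x₀)).eLpNorm_indicator_le Fact.out hp (half_pos hr)
  obtain ⟨D, hDT, hD, hD0, hDle⟩ := exists_measurableSet_subset_measure_pos_le hatom hT hT0 hTfin
    (ENNReal.ofReal_pos.2 (lt_min hδ₁ hδ₂))
  have hmem : ∀ y : Lp E₁ p μ,
      eLpNorm (D.indicator (y - x₀ : Lp E₁ p μ)) p μ ≤ ENNReal.ofReal (r / 2) →
      LpPiecewise hD x₀ y ∈ V ∩ U := by
    intro y hy
    refine hball ?_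
    rw [mem_ball, dist_LpPiecewise_left]
    exact (ENNReal.toReal_le_of_le_ofReal (half_pos hr).le hy).trans_lt (half_lt_self hr)
  have hx₁ := hmem y₁ (hsmall₁ D hD (hDle.trans (ENNReal.ofReal_le_ofReal (min_le_left _ _))))
  have hx₂ := hmem y₂ (hsmall₂ D hD (hDle.trans (ENNReal.ofReal_le_ofReal (min_le_right _ _))))
  set x₁ := LpPiecewise hD x₀ y₁
  set x₂ := LpPiecewise hD x₀ y₂
  have hx_sub : ⇑(x₁ - x₂) =ᵐ[μ] D.indicator h := by
    filter_upwards [Lp.coeFn_sub x₁ x₂, coeFn_LpPiecewise hD x₀ y₁, coeFn_LpPiecewise hD x₀ y₂]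
      with t h₀ h₁ h₂
    rw [h₀, Pi.sub_apply]
    by_cases ht : t ∈ D
    · rw [h₁.1 ht, h₂.1 ht, indicator_of_mem ht]
    · rw [h₁.2 ht, h₂.2 ht, indicator_of_notMem ht, sub_self]
  have hF_sub : ⇑(F x₁ - F x₂) =ᵐ[μ] D.indicator g := by
    filter_upwards [Lp.coeFn_sub (F x₁) (F x₂), coeFn_LpPiecewise hD x₀ y₁,
      coeFn_LpPiecewise hD x₀ y₂, hF x₁ hx₁.2, hF x₂ hx₂.2, hF y₁ hy₁, hF y₂ hy₂]
      with t h₀ h₁ h₂ hFx₁ hFx₂ hFy₁ hFy₂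
    rw [h₀, Pi.sub_apply, hFx₁, hFx₂]
    by_cases ht : t ∈ D
    · rw [h₁.1 ht, h₂.1 ht, indicator_of_mem ht, hg_def]
      simp only [hFy₁, hFy₂]
    · rw [h₁.2 ht, h₂.2 ht, indicator_of_notMem ht, sub_self]
  have hle : eLpNorm g p (μ.restrict D) ≤ eLpNorm (L • fun t => ‖h t‖) p (μ.restrict D) := by
    rw [eLpNorm_const_smul, eLpNorm_norm, ← eLpNorm_indicator_eq_eLpNorm_restrict hD,
      ← eLpNorm_indicator_eq_eLpNorm_restrict hD, ← eLpNorm_congr_ae hx_sub,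
      ← eLpNorm_congr_ae hF_sub, ← Lp.enorm_def, ← Lp.enorm_def, ← ofReal_norm, ← ofReal_norm,
      ← ofReal_norm, Real.norm_of_nonneg hL, ← ENNReal.ofReal_mul hL]
    exact ENNReal.ofReal_le_ofReal (hLip x₁ hx₁ x₂ hx₂)
  refine hle.not_gt (eLpNorm_lt_eLpNorm_of_ae_lt hp0 hp ?_ ?_ hgm.aestronglyMeasurable ?_)
  · rw [Ne, Measure.restrict_eq_zero]
    exact hD0.ne'
  · exact (hh.restrict D).norm.const_smul L
  · filter_upwards [ae_restrict_mem hD] with t ht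
    have hlt : L * ‖h t‖ < ‖g t‖ := hTS (hDT ht)
    simpa [abs_of_nonneg hL] using hlt
end

section
/- Let Ω be a measure space containing no atoms of finite measure, E₁ and E₂ Banach spaces, 1 ≤ p ≤ q < ∞, X = L_p(Ω, E₁) and Y = L_q(Ω, E₂). Let x₀ be an interior point of U ⊆ X, let M ⊆ X × X contain {(x,x) : x ∈ U} ∪ (V × {x₀}) for some V ⊆ X with U ⊆ V, let G : M → Y, set F(x) := G(x, x) for x ∈ U, and suppose the map x ↦ G(x, x₀) on V is locally determined. Suppose G is diagonal-differentiable at (x₀, x₀) with respect to the second variable with diagonal-derivative D₂G(x₀, x₀). If the image F(B_r(x₀) ∩ U) is relatively compact in Y for some r > 0 and D₂G(x₀, x₀) : X → Y is a compact operator, then x ↦ G(x, x₀) is Fréchet differentiable at x₀ with derivative 0. If in addition x ↦ G(x, x₀) has maximal domain V, then x ↦ G(x, x₀) is constant on V and V = X. -/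
open MeasureTheory Filter Metric Set
open scoped Topology ENNReal

/-- Every measurable set of positive finite measure has a measurable subset of strictly smaller
positive measure. -/
def NoFiniteAtoms {Ω : Type*} [MeasurableSpace Ω] (μ : Measure Ω) : Prop :=
  ∀ T : Set Ω, MeasurableSet T → 0 < μ T → μ T < ⊤ →
    ∃ D ⊆ T, MeasurableSet D ∧ 0 < μ D ∧ μ D < μ T

section FiniteMeasure

variable {Ω : Type*} [MeasurableSpace Ω] {ν : Measure Ω} [IsFiniteMeasure ν]

theorem NoFiniteAtoms.exists_subset_pos_le (hν : NoFiniteAtoms ν) {T : Set Ω}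
    (hT : MeasurableSet T) (hT0 : 0 < ν T) {ε : ℝ≥0∞} (hε : ε ≠ 0) :
    ∃ D ⊆ T, MeasurableSet D ∧ 0 < ν D ∧ ν D ≤ ε := by
  have key : ∀ n : ℕ, ∃ D ⊆ T, MeasurableSet D ∧ 0 < ν D ∧ ν D ≤ 2⁻¹ ^ n * ν T := by
    intro n
    induction n with
    | zero => exact ⟨T, Subset.rfl, hT, hT0, by simp⟩
    | succ n ih =>
      obtain ⟨D, hDT, hD, hD0, hDn⟩ := ih
      obtain ⟨C, hCD, hC, hC0, hClt⟩ := hν D hD hD0 (measure_lt_top ν D)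
      have hsum : ν C + ν (D \ C) = ν D := by
        simpa [inter_eq_right.mpr hCD] using measure_inter_add_sdiff (μ := ν) D hC
      have hdiff0 : 0 < ν (D \ C) := by
        rw [measure_sdiff hCD hC.nullMeasurableSet (measure_ne_top ν C)]
        exact tsub_pos_of_lt hClt
      have hhalf : 2⁻¹ * ν D ≤ 2⁻¹ ^ (n + 1) * ν T := by
        rw [pow_succ', mul_assoc]
        gcongr
      have h2 : 2⁻¹ * ν D + 2⁻¹ * ν D = ν D := by
        rw [← add_mul, ENNReal.inv_two_add_inv_two, one_mul]
      rcases le_or_gt (ν C) (2⁻¹ * ν D) with h | h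
      · exact ⟨C, hCD.trans hDT, hC, hC0, h.trans hhalf⟩
      · refine ⟨D \ C, sdiff_subset.trans hDT, hD.diff hC, hdiff0, le_trans ?_ hhalf⟩
        by_contra! h'
        have := ENNReal.add_lt_add h h'
        rw [hsum, h2] at this
        exact this.false
  have hne : ε / ν T ≠ 0 := (ENNReal.div_pos hε (measure_ne_top ν T)).ne'
  obtain ⟨n, hn⟩ := ENNReal.exists_inv_two_pow_lt hne
  obtain ⟨D, hDT, hD, hD0, hDn⟩ := key n
  refine ⟨D, hDT, hD, hD0, hDn.trans ?_⟩
  calc 2⁻¹ ^ n * ν T ≤ ε / ν T * ν T := by gcongr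
    _ = ε := ENNReal.div_mul_cancel hT0.ne' (measure_ne_top ν T)

/-- Sierpiński's theorem: an atomless finite measure takes all intermediate values. -/
theorem NoFiniteAtoms.exists_subset_measure_eq (hν : NoFiniteAtoms ν) {A : Set Ω}
    (hA : MeasurableSet A) {t : ℝ≥0∞} (ht : t ≤ ν A) :
    ∃ B ⊆ A, MeasurableSet B ∧ ν B = t := by
  have ht_top : t ≠ ⊤ := (ht.trans_lt (measure_lt_top ν A)).ne
  let S := {B : Set Ω // MeasurableSet B ∧ B ⊆ A ∧ ν B ≤ t}
  have step : ∀ (n : ℕ) (B : S), ∃ B' : S, B.1 ⊆ B'.1 ∧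
      ∀ C : S, B.1 ⊆ C.1 → ν C.1 ≤ ν B'.1 + (n : ℝ≥0∞)⁻¹ := by
    intro n B
    by_contra! hcon
    let s := ⨆ C : {C : S // B.1 ⊆ C.1}, ν C.1.1
    have hs_top : s ≠ ⊤ := ((iSup_le fun C => C.1.2.2.2).trans_lt ht_top.lt_top).ne
    have hn : (n : ℝ≥0∞)⁻¹ ≠ 0 := ENNReal.inv_ne_zero.mpr (ENNReal.natCast_ne_top n)
    have hle : ∀ C : S, B.1 ⊆ C.1 → ν C.1 ≤ s := fun C hC =>
      le_iSup (fun C : {C : S // B.1 ⊆ C.1} => ν C.1.1) ⟨C, hC⟩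
    have hs0 : s ≠ 0 := by
      obtain ⟨C, hC, hlt⟩ := hcon B Subset.rfl
      exact ((zero_le.trans_lt hlt).trans_le (hle C hC)).ne'
    obtain ⟨⟨B', hB'⟩, hlt⟩ := lt_iSup_iff.mp (ENNReal.sub_lt_self hs_top hs0 hn)
    obtain ⟨C, hC, hlt'⟩ := hcon B' hB'
    exact ((tsub_le_iff_right.mp hlt.le).trans_lt (hlt'.trans_le (hle C hC))).false
  choose next hnext_sub hnext using step
  let b : ℕ → S := fun n => Nat.rec ⟨∅, MeasurableSet.empty, empty_subset _, by simp⟩ next n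
  have hb_mono : Monotone fun n => (b n).1 :=
    monotone_nat_of_le_succ fun n => hnext_sub n (b n)
  have hB_meas : MeasurableSet (⋃ n, (b n).1) := MeasurableSet.iUnion fun n => (b n).2.1
  have hB_sub : (⋃ n, (b n).1) ⊆ A := iUnion_subset fun n => (b n).2.2.1
  have hB_le : ν (⋃ n, (b n).1) ≤ t := by
    rw [hb_mono.measure_iUnion]
    exact iSup_le fun n => (b n).2.2.2
  refine ⟨⋃ n, (b n).1, hB_sub, hB_meas, le_antisymm hB_le ?_⟩
  by_contra! hlt
  have hrest : 0 < ν (A \ ⋃ n, (b n).1) := by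
    rw [measure_sdiff hB_sub hB_meas.nullMeasurableSet (measure_ne_top _ _)]
    exact tsub_pos_of_lt (hlt.trans_le ht)
  obtain ⟨C, hCA, hC, hC0, hCle⟩ := hν.exists_subset_pos_le (hA.diff hB_meas) hrest
    (tsub_pos_of_lt hlt).ne'
  have hdisj : Disjoint (⋃ n, (b n).1) C :=
    (disjoint_sdiff_right).mono_right hCA
  have hunion : ν ((⋃ n, (b n).1) ∪ C) = ν (⋃ n, (b n).1) + ν C := measure_union hdisj hC
  let c : S := ⟨(⋃ n, (b n).1) ∪ C, hB_meas.union hC,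
    union_subset hB_sub (hCA.trans sdiff_subset), by
      rw [hunion]
      calc _ ≤ ν (⋃ n, (b n).1) + (t - ν (⋃ n, (b n).1)) := by gcongr
        _ = t := add_tsub_cancel_of_le hB_le⟩
  obtain ⟨n, hn⟩ := ENNReal.exists_inv_nat_lt hC0.ne'
  have h1 := hnext n (b n) c ((subset_iUnion (fun n => (b n).1) n).trans subset_union_left)
  have h2 : ν (next n (b n)).1 ≤ ν (⋃ n, (b n).1) :=
    measure_mono (subset_iUnion (fun n => (b n).1) (n + 1))
  have h3 : ν (⋃ n, (b n).1) + ν C ≤ ν (⋃ n, (b n).1) + (n : ℝ≥0∞)⁻¹ := by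
    rw [← hunion]
    exact h1.trans (by gcongr)
  exact (((ENNReal.add_le_add_iff_left (measure_ne_top _ _)).mp h3).trans_lt hn).false

/-- For finitely many measurable sets there is a measurable set which halves every set of the
partition they generate; its symmetric difference with each of them has half the total measure. -/
theorem NoFiniteAtoms.exists_measure_symmDiff_eq (hν : NoFiniteAtoms ν) {ι : Type*} [Finite ι]
    {D : ι → Set Ω} (hD : ∀ i, MeasurableSet (D i)) :
    ∃ B, MeasurableSet B ∧ ∀ i, ν (symmDiff B (D i)) = 2⁻¹ * ν univ := by
  let A : Set ι → Set Ω := fun s => {t | ∀ i, t ∈ D i ↔ i ∈ s}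
  have hA : ∀ s, MeasurableSet (A s) := by
    intro s
    have : A s = ⋂ i, {t | t ∈ D i ↔ i ∈ s} := by ext; simp [A]
    rw [this]
    refine MeasurableSet.iInter fun i => ?_
    by_cases hi : i ∈ s
    · simpa [hi] using hD i
    · simp only [hi, iff_false]
      exact (hD i).compl
  have hA_eq : ∀ {t s s'}, t ∈ A s → t ∈ A s' → s = s' := fun h h' =>
    Set.ext fun i => (h i).symm.trans (h' i)
  have hA_disj : Pairwise (Function.onFun Disjoint A) := fun s s' hne =>
    disjoint_left.mpr fun t h h' => hne (hA_eq h h')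
  have hA_univ : ⋃ s, A s = univ :=
    eq_univ_of_forall fun t => mem_iUnion.mpr ⟨{i | t ∈ D i}, fun _ => Iff.rfl⟩
  have hhalf : ∀ s, 2⁻¹ * ν (A s) ≤ ν (A s) := fun s =>
    (mul_le_mul_left (ENNReal.inv_le_one.mpr one_le_two) _).trans_eq (one_mul _)
  choose B hBA hB hBν using fun s => hν.exists_subset_measure_eq (hA s) (hhalf s)
  have hsum : ∀ E, MeasurableSet E → ν E = ∑' s, ν (E ∩ A s) := by
    intro E hE
    rw [← measure_iUnion (fun s s' hne => (hA_disj hne).mono inter_subset_right inter_subset_right)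
      fun s => hE.inter (hA s), ← inter_iUnion, hA_univ, inter_univ]
  have hBm : MeasurableSet (⋃ s, B s) := MeasurableSet.iUnion hB
  have hmem : ∀ {t s}, t ∈ A s → (t ∈ ⋃ s, B s) → t ∈ B s := by
    intro t s ht hu
    obtain ⟨s', hs'⟩ := mem_iUnion.mp hu
    rwa [hA_eq ht (hBA s' hs')]
  refine ⟨⋃ s, B s, hBm, fun i => ?_⟩
  rw [hsum _ (hBm.symmDiff (hD i)), hsum univ MeasurableSet.univ, ← ENNReal.tsum_mul_left]
  refine tsum_congr fun s => ?_
  rw [univ_inter]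
  by_cases hi : i ∈ s
  · have : symmDiff (⋃ s, B s) (D i) ∩ A s = A s \ B s := by
      ext t
      constructor
      · rintro ⟨h | h, ht⟩
        · exact absurd ((ht i).mpr hi) h.2
        · exact ⟨ht, fun hb => h.2 (mem_iUnion.mpr ⟨s, hb⟩)⟩
      · rintro ⟨ht, hb⟩
        exact ⟨Or.inr ⟨(ht i).mpr hi, fun hu => hb (hmem ht hu)⟩, ht⟩
    rw [this, measure_sdiff (hBA s) (hB s).nullMeasurableSet (measure_ne_top _ _), hBν]
    refine ENNReal.sub_eq_of_eq_add (ENNReal.mul_ne_top (by simp) (measure_ne_top _ _)) ?_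
    rw [← add_mul, ENNReal.inv_two_add_inv_two, one_mul]
  · have : symmDiff (⋃ s, B s) (D i) ∩ A s = B s := by
      ext t
      constructor
      · rintro ⟨h | h, ht⟩
        · exact hmem ht h.1
        · exact absurd ((ht i).mp h.1) hi
      · intro hb
        have ht := hBA s hb
        exact ⟨Or.inl ⟨mem_iUnion.mpr ⟨s, hb⟩, fun hd => hi ((ht i).mp hd)⟩, ht⟩
    rw [this, hBν]

/-- A linear bound between measures holds globally if it holds on all sets of small measure for
an atomless measure. -/
theorem NoFiniteAtoms.measure_le_mul_of_small (hν : NoFiniteAtoms ν) {ν' : Measure Ω}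
    {c κ : ℝ≥0∞} (hc : c ≠ 0)
    (h : ∀ A, MeasurableSet A → ν A ≤ c → ν' A ≤ κ * ν A) {A : Set Ω} (hA : MeasurableSet A) :
    ν' A ≤ κ * ν A := by
  have key : ∀ n : ℕ, ∀ A, MeasurableSet A → ν A ≤ (n + 1) * c → ν' A ≤ κ * ν A := by
    intro n
    induction n with
    | zero => simpa using h
    | succ n ih =>
      intro A hA hle
      rcases le_or_gt (ν A) c with hAc | hAc
      · exact h A hA hAc
      obtain ⟨B, hBA, hB, hBc⟩ := hν.exists_subset_measure_eq hA hAc.le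
      have hctop : c ≠ ⊤ := hAc.ne_top
      have hdiff : ν (A \ B) ≤ (n + 1) * c := by
        rw [measure_sdiff hBA hB.nullMeasurableSet (measure_ne_top _ _), hBc, tsub_le_iff_right]
        refine hle.trans_eq ?_
        push_cast
        ring
      have hsum : ∀ ρ : Measure Ω, ρ A = ρ B + ρ (A \ B) := fun ρ => by
        simpa [inter_eq_right.mpr hBA] using (measure_inter_add_sdiff (μ := ρ) A hB).symm
      rw [hsum ν', hsum ν, mul_add]
      exact add_le_add (h B hB hBc.le) (ih _ (hA.diff hB) hdiff)
  obtain ⟨n, hn⟩ := ENNReal.exists_nat_mul_gt hc (measure_ne_top ν A)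
  exact key n A hA (hn.le.trans (by gcongr; exact le_self_add))

end FiniteMeasure

section Lp

variable {Ω : Type*} [MeasurableSpace Ω] {μ : Measure Ω}

theorem NoFiniteAtoms.withDensity (hμ : NoFiniteAtoms μ) {f : Ω → ℝ≥0∞} (hf : Measurable f)
    (hfin : ∫⁻ t, f t ∂μ ≠ ⊤) : NoFiniteAtoms (μ.withDensity f) := by
  intro T hT hT0 _
  have := isFiniteMeasure_withDensity hfin
  have hpos : ∀ D, MeasurableSet D → D ⊆ {t | f t ≠ 0} → 0 < μ D → 0 < μ.withDensity f D := by
    intro D hD hsub h0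
    rw [pos_iff_ne_zero, Ne, withDensity_apply_eq_zero hf]
    rwa [inter_eq_right.mpr hsub, ← Ne, ← pos_iff_ne_zero]
  have hex : ∃ n : ℕ, 0 < μ (T ∩ {t | (n : ℝ≥0∞)⁻¹ ≤ f t}) := by
    by_contra! hcon
    have hnull : μ (⋃ n : ℕ, T ∩ {t | (n : ℝ≥0∞)⁻¹ ≤ f t}) = 0 :=
      measure_iUnion_null fun n => nonpos_iff_eq_zero.mp (hcon n)
    refine hT0.ne' ((withDensity_apply_eq_zero hf).mpr (measure_mono_null ?_ hnull))
    rintro t ⟨ht, htT⟩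
    obtain ⟨n, hn⟩ := ENNReal.exists_inv_nat_lt ht
    exact mem_iUnion.mpr ⟨n, htT, hn.le⟩
  obtain ⟨n, hn⟩ := hex
  have hSm : MeasurableSet (T ∩ {t | (n : ℝ≥0∞)⁻¹ ≤ f t}) :=
    hT.inter (measurableSet_le measurable_const hf)
  have hn0 : (n : ℝ≥0∞)⁻¹ ≠ 0 := ENNReal.inv_ne_zero.mpr (ENNReal.natCast_ne_top n)
  have hSsub : T ∩ {t | (n : ℝ≥0∞)⁻¹ ≤ f t} ⊆ {t | f t ≠ 0} := fun t ht h0 =>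
    hn0 (nonpos_iff_eq_zero.mp (ht.2.trans_eq h0))
  obtain ⟨ε, hε0, hε1, hε⟩ : ∃ ε : ℝ≥0∞, ε ≠ 0 ∧ ε ≠ ⊤ ∧ ε ≤ (n : ℝ≥0∞)⁻¹ :=
    ⟨min 1 (n : ℝ≥0∞)⁻¹, by simp, by simp, min_le_right _ _⟩
  have hSfin : μ (T ∩ {t | (n : ℝ≥0∞)⁻¹ ≤ f t}) < ⊤ :=
    (measure_mono fun t ht => hε.trans ht.2).trans_lt
      (meas_ge_le_lintegral_div hf.aemeasurable hε0 hε1 |>.trans_lt (ENNReal.div_lt_top hfin hε0))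
  obtain ⟨D, hDS, hD, hD0, hDlt⟩ := hμ _ hSm hn hSfin
  refine ⟨D, hDS.trans inter_subset_left, hD, hpos D hD (hDS.trans hSsub) hD0, ?_⟩
  have hd : 0 < μ.withDensity f ((T ∩ {t | (n : ℝ≥0∞)⁻¹ ≤ f t}) \ D) := by
    refine hpos _ (hSm.diff hD) (sdiff_subset.trans hSsub) ?_
    rw [measure_sdiff hDS hD.nullMeasurableSet (hDlt.trans hSfin).ne]
    exact tsub_pos_of_lt hDlt
  have hd' : 0 < μ.withDensity f (T \ D) :=
    hd.trans_le (measure_mono (sdiff_subset_sdiff_left inter_subset_left))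
  rw [measure_sdiff (hDS.trans inter_subset_left) hD.nullMeasurableSet (measure_ne_top _ _)] at hd'
  exact tsub_pos_iff_lt.mp hd'

variable {E : Type*} [NormedAddCommGroup E] {p : ℝ≥0∞}

/-- The product of an `Lp` function with the indicator function of a measurable set. -/
noncomputable def lpIndicator {D : Set Ω} (hD : MeasurableSet D) (f : Lp E p μ) : Lp E p μ :=
  ((Lp.memLp f).indicator hD).toLp _

theorem coeFn_lpIndicator {D : Set Ω} (hD : MeasurableSet D) (f : Lp E p μ) :
    lpIndicator hD f =ᵐ[μ] D.indicator f :=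
  MemLp.coeFn_toLp _

theorem norm_lpIndicator_le {D : Set Ω} (hD : MeasurableSet D) (f : Lp E p μ) :
    ‖lpIndicator hD f‖ ≤ ‖f‖ := by
  refine Lp.norm_le_norm_of_ae_le ?_
  filter_upwards [coeFn_lpIndicator hD f] with t ht
  rw [ht]
  exact norm_indicator_le_norm_self _ _

/-- The measure with density `‖f‖ ^ p`. -/
noncomputable def normRpowMeasure (f : Lp E p μ) : Measure Ω :=
  μ.withDensity fun t => ‖f t‖ₑ ^ p.toReal

theorem enorm_rpow_eq_normRpowMeasure (hp0 : p ≠ 0) (hp : p ≠ ⊤) {f g : Lp E p μ} {D : Set Ω}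
    (hD : MeasurableSet D) (h : ∀ᵐ t ∂μ, ‖g t‖ₑ = D.indicator (fun t => ‖f t‖ₑ) t) :
    ‖g‖ₑ ^ p.toReal = normRpowMeasure f D := by
  have hpos := ENNReal.toReal_pos hp0 hp
  rw [Lp.enorm_def, eLpNorm_eq_lintegral_rpow_enorm_toReal hp0 hp, ← ENNReal.rpow_mul,
    one_div_mul_cancel hpos.ne', ENNReal.rpow_one, normRpowMeasure, withDensity_apply _ hD,
    ← lintegral_indicator hD]
  refine lintegral_congr_ae ?_
  filter_upwards [h] with t ht
  rw [ht]
  by_cases hmem : t ∈ D <;> simp [hmem, hpos]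

theorem enorm_rpow_eq_normRpowMeasure_univ (hp0 : p ≠ 0) (hp : p ≠ ⊤) (f : Lp E p μ) :
    ‖f‖ₑ ^ p.toReal = normRpowMeasure f univ :=
  enorm_rpow_eq_normRpowMeasure hp0 hp MeasurableSet.univ (by simp)

theorem enorm_lpIndicator_rpow (hp0 : p ≠ 0) (hp : p ≠ ⊤) (f : Lp E p μ) {D : Set Ω}
    (hD : MeasurableSet D) : ‖lpIndicator hD f‖ₑ ^ p.toReal = normRpowMeasure f D := by
  refine enorm_rpow_eq_normRpowMeasure hp0 hp hD ?_
  filter_upwards [coeFn_lpIndicator hD f] with t ht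
  rw [ht, enorm_indicator_eq_indicator_enorm]

theorem enorm_lpIndicator_sub_rpow (hp0 : p ≠ 0) (hp : p ≠ ⊤) (f : Lp E p μ) {B D : Set Ω}
    (hB : MeasurableSet B) (hD : MeasurableSet D) :
    ‖lpIndicator hB f - lpIndicator hD f‖ₑ ^ p.toReal = normRpowMeasure f (symmDiff B D) := by
  refine enorm_rpow_eq_normRpowMeasure hp0 hp (hB.symmDiff hD) ?_
  filter_upwards [coeFn_lpIndicator hB f, coeFn_lpIndicator hD f,
    Lp.coeFn_sub (lpIndicator hB f) (lpIndicator hD f)] with t htB htD ht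
  rw [ht, Pi.sub_apply, htB, htD]
  by_cases h1 : t ∈ B <;> by_cases h2 : t ∈ D <;> simp [h1, h2, mem_symmDiff]

theorem isFiniteMeasure_normRpowMeasure (hp0 : p ≠ 0) (hp : p ≠ ⊤) (f : Lp E p μ) :
    IsFiniteMeasure (normRpowMeasure f) := by
  refine ⟨?_⟩
  rw [← enorm_rpow_eq_normRpowMeasure_univ hp0 hp]
  exact ENNReal.rpow_lt_top_of_nonneg ENNReal.toReal_nonneg enorm_ne_top

theorem NoFiniteAtoms.normRpowMeasure (hμ : NoFiniteAtoms μ) (hp0 : p ≠ 0) (hp : p ≠ ⊤)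
    (f : Lp E p μ) : NoFiniteAtoms (normRpowMeasure f) := by
  refine hμ.withDensity ((Lp.stronglyMeasurable f).enorm.pow_const _) ?_
  have := isFiniteMeasure_normRpowMeasure hp0 hp f
  have h := measure_ne_top (_root_.normRpowMeasure f) univ
  rwa [_root_.normRpowMeasure, withDensity_apply _ MeasurableSet.univ, setLIntegral_univ] at h

theorem norm_lpIndicator_le_of_normRpowMeasure_le [Fact (1 ≤ p)] (hp0 : p ≠ 0) (hp : p ≠ ⊤) {f : Lp E p μ}
    {D : Set Ω} (hD : MeasurableSet D) {δ : ℝ} (hδ : 0 ≤ δ)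
    (h : _root_.normRpowMeasure f D ≤ ENNReal.ofReal δ ^ p.toReal) : ‖lpIndicator hD f‖ ≤ δ := by
  rw [← enorm_lpIndicator_rpow hp0 hp f hD,
    ENNReal.rpow_le_rpow_iff (ENNReal.toReal_pos hp0 hp)] at h
  rwa [← ofReal_norm, ENNReal.ofReal_le_ofReal_iff hδ] at h

/-- If the truncations of `f` to measurable sets have a finite `r`-net, then `‖f‖ ≤ 4 * r`. -/
theorem norm_le_of_lpIndicator_net [Fact (1 ≤ p)] (hμ : NoFiniteAtoms μ) (hp : p ≠ ⊤)
    (f : Lp E p μ) {s : Set (Lp E p μ)} (hs : s.Finite) {r : ℝ}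
    (h : ∀ (D : Set Ω) (hD : MeasurableSet D), ∃ z ∈ s, ‖lpIndicator hD f - z‖ ≤ r) :
    ‖f‖ ≤ 4 * r := by
  have hp1 : 1 ≤ p := Fact.out
  have hp0 : p ≠ 0 := (zero_lt_one.trans_le hp1).ne'
  have := isFiniteMeasure_normRpowMeasure hp0 hp f
  have := hs.to_subtype
  have hcenter : ∀ z : s, ∃ D : {D : Set Ω // MeasurableSet D},
      (∃ D' : {D : Set Ω // MeasurableSet D}, ‖lpIndicator D'.2 f - z‖ ≤ r) →
        ‖lpIndicator D.2 f - z‖ ≤ r := by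
    intro z
    by_cases hz : ∃ D' : {D : Set Ω // MeasurableSet D}, ‖lpIndicator D'.2 f - z‖ ≤ r
    · exact hz.imp fun D hD _ => hD
    · exact ⟨⟨∅, MeasurableSet.empty⟩, fun h' => absurd h' hz⟩
  choose D hD using hcenter
  obtain ⟨B, hB, hBD⟩ :=
    (hμ.normRpowMeasure hp0 hp f).exists_measure_symmDiff_eq fun z => (D z).2
  obtain ⟨z, hz, hBz⟩ := h B hB
  have hDz := hD ⟨z, hz⟩ ⟨⟨B, hB⟩, hBz⟩
  have hdist : ‖lpIndicator hB f - lpIndicator (D ⟨z, hz⟩).2 f‖ ≤ 2 * r := by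
    have := norm_sub_le_norm_sub_add_norm_sub (lpIndicator hB f) z (lpIndicator (D ⟨z, hz⟩).2 f)
    rw [norm_sub_rev z] at this
    linarith
  have hr : 0 ≤ r := (norm_nonneg _).trans hBz
  have hpow : 2⁻¹ * ‖f‖ₑ ^ p.toReal ≤ ENNReal.ofReal (2 * r) ^ p.toReal := by
    rw [enorm_rpow_eq_normRpowMeasure_univ hp0 hp, ← hBD ⟨z, hz⟩,
      ← enorm_lpIndicator_sub_rpow hp0 hp f hB (D ⟨z, hz⟩).2, ← ofReal_norm]
    gcongr
  have hp1' : 1 ≤ p.toReal := by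
    simpa using ENNReal.toReal_mono hp hp1
  have hpow' : ‖f‖ₑ ^ p.toReal ≤ (2 * ENNReal.ofReal (2 * r)) ^ p.toReal := by
    rw [ENNReal.mul_rpow_of_nonneg _ _ ENNReal.toReal_nonneg]
    calc ‖f‖ₑ ^ p.toReal = 2 * (2⁻¹ * ‖f‖ₑ ^ p.toReal) := by
          rw [← mul_assoc, ENNReal.mul_inv_cancel two_ne_zero ENNReal.ofNat_ne_top, one_mul]
      _ ≤ 2 ^ p.toReal * ENNReal.ofReal (2 * r) ^ p.toReal := by
          gcongr
          exact (ENNReal.rpow_one 2).symm.le.trans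
            (ENNReal.rpow_le_rpow_of_exponent_le one_le_two hp1')
  rw [ENNReal.rpow_le_rpow_iff (ENNReal.toReal_pos hp0 hp), ← ofReal_norm,
    show (2 : ℝ≥0∞) = ENNReal.ofReal 2 by simp, ← ENNReal.ofReal_mul two_pos.le,
    ENNReal.ofReal_le_ofReal_iff (by positivity)] at hpow'
  linarith

variable {E₂ : Type*} [NormedAddCommGroup E₂] {q : ℝ≥0∞}

theorem map_add_lpIndicator_sub {V : Set (Lp E p μ)} {H : Lp E p μ → Lp E₂ q μ}
    (hloc : ∀ D : Set Ω, MeasurableSet D → ∀ x ∈ V, ∀ x' ∈ V,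
      (∀ᵐ t ∂μ, t ∈ D → x t = x' t) → ∀ᵐ t ∂μ, t ∈ D → H x t = H x' t)
    {x₀ h : Lp E p μ} (hx₀ : x₀ ∈ V) (hh : x₀ + h ∈ V) {D : Set Ω} (hD : MeasurableSet D)
    (hDV : x₀ + lpIndicator hD h ∈ V) :
    H (x₀ + lpIndicator hD h) - H x₀ = lpIndicator hD (H (x₀ + h) - H x₀) := by
  have hon := hloc D hD _ hDV _ hh (by
    filter_upwards [coeFn_lpIndicator hD h, Lp.coeFn_add x₀ h,
      Lp.coeFn_add x₀ (lpIndicator hD h)] with t h1 h2 h3 ht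
    rw [h3, h2, Pi.add_apply, Pi.add_apply, h1, indicator_of_mem ht])
  have hoff := hloc Dᶜ hD.compl _ hDV _ hx₀ (by
    filter_upwards [coeFn_lpIndicator hD h, Lp.coeFn_add x₀ (lpIndicator hD h)] with t h1 h3 ht
    rw [h3, Pi.add_apply, h1, indicator_of_notMem ht, add_zero])
  refine Lp.ext ?_
  filter_upwards [hon, hoff, coeFn_lpIndicator hD (H (x₀ + h) - H x₀),
    Lp.coeFn_sub (H (x₀ + lpIndicator hD h)) (H x₀), Lp.coeFn_sub (H (x₀ + h)) (H x₀)]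
    with t h1 h2 h3 h4 h5
  rw [h3, h4, Pi.sub_apply]
  by_cases ht : t ∈ D
  · rw [indicator_of_mem ht, h5, Pi.sub_apply, h1 ht]
  · rw [indicator_of_notMem ht, h2 ht, sub_self]

/-- A locally determined map into `L_q` with vanishing derivative at an interior point of its
domain in `L_p`, `p ≤ q`, is constant. -/
theorem eq_of_hasFDerivAt_zero [NormedSpace ℝ E] [NormedSpace ℝ E₂] [Fact (1 ≤ p)]
    [Fact (1 ≤ q)] (hμ : NoFiniteAtoms μ) (hpq : p ≤ q) (hq : q ≠ ⊤)
    {V : Set (Lp E p μ)} {H : Lp E p μ → Lp E₂ q μ}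
    (hloc : ∀ D : Set Ω, MeasurableSet D → ∀ x ∈ V, ∀ x' ∈ V,
      (∀ᵐ t ∂μ, t ∈ D → x t = x' t) → ∀ᵐ t ∂μ, t ∈ D → H x t = H x' t)
    {x₀ : Lp E p μ} (hx₀ : V ∈ 𝓝 x₀)
    (hH : HasFDerivAt H (0 : Lp E p μ →L[ℝ] Lp E₂ q μ) x₀) {x : Lp E p μ} (hx : x ∈ V) :
    H x = H x₀ := by
  have hp0 : p ≠ 0 := (zero_lt_one.trans_le (Fact.out : 1 ≤ p)).ne'
  have hq0 : q ≠ 0 := (zero_lt_one.trans_le (Fact.out : 1 ≤ q)).ne'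
  have hp : p ≠ ⊤ := (hpq.trans_lt hq.lt_top).ne
  have hqpos := ENNReal.toReal_pos hq0 hq
  have hx₀V := mem_of_mem_nhds hx₀
  obtain ⟨h, rfl⟩ : ∃ h, x = x₀ + h := ⟨x - x₀, by abel⟩
  have := isFiniteMeasure_normRpowMeasure hp0 hp h
  have hatom := hμ.normRpowMeasure hp0 hp h
  obtain ⟨ρ, hρ, hball⟩ := Metric.mem_nhds_iff.mp hx₀
  rw [← sub_eq_zero, ← enorm_eq_zero]
  by_contra hne
  have hne' : normRpowMeasure (H (x₀ + h) - H x₀) univ ≠ 0 := by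
    rw [← enorm_rpow_eq_normRpowMeasure_univ hq0 hq]
    simpa [ENNReal.rpow_eq_zero_iff, hqpos, hqpos.not_gt] using hne
  obtain ⟨κ, hκ, hlt⟩ :=
    ENNReal.exists_nnreal_pos_mul_lt (measure_ne_top (normRpowMeasure h) univ) hne'
  have hηpos : 0 < κ ^ (1 / q.toReal) := NNReal.rpow_pos hκ
  have hder := (hasFDerivAt_iff_isLittleO_nhds_zero.mp hH).def
    (NNReal.coe_pos.mpr hηpos)
  obtain ⟨δ, hδ, hδball⟩ := Metric.eventually_nhds_iff.mp hder
  obtain ⟨d, hd0, hd⟩ := exists_between (lt_min (lt_min hδ hρ) one_pos)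
  obtain ⟨⟨hdδ, hdρ⟩, hd1⟩ : (d < δ ∧ d < ρ) ∧ d < 1 := by simpa using hd
  refine hlt.not_ge (hatom.measure_le_mul_of_small (c := ENNReal.ofReal d ^ p.toReal) ?_ ?_
    MeasurableSet.univ)
  · simp [ENNReal.rpow_eq_zero_iff, hd0]
  intro A hA hAc
  have hnorm := norm_lpIndicator_le_of_normRpowMeasure_le hp0 hp hA hd0.le hAc
  have hAV : x₀ + lpIndicator hA h ∈ V := hball (by simpa using hnorm.trans_lt hdρ)
  have hest := hδball (y := lpIndicator hA h) (by simpa using hnorm.trans_lt hdδ)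
  rw [_root_.zero_apply, sub_zero,
    map_add_lpIndicator_sub hloc hx₀V hx hA hAV] at hest
  have hest' : ‖lpIndicator hA (H (x₀ + h) - H x₀)‖ₑ ≤
      (κ ^ (1 / q.toReal) : NNReal) * ‖lpIndicator hA h‖ₑ := by
    rw [enorm_eq_nnnorm, enorm_eq_nnnorm]
    exact_mod_cast hest
  rw [← enorm_lpIndicator_rpow hq0 hq _ hA, ← enorm_lpIndicator_rpow hp0 hp _ hA]
  have hle1 : ‖lpIndicator hA h‖ₑ ≤ 1 := by
    rw [enorm_eq_nnnorm]
    exact_mod_cast hnorm.trans hd1.le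
  calc _ ≤ ((κ ^ (1 / q.toReal) : NNReal) * ‖lpIndicator hA h‖ₑ) ^ q.toReal := by gcongr
    _ = κ * ‖lpIndicator hA h‖ₑ ^ q.toReal := by
      rw [ENNReal.mul_rpow_of_nonneg _ _ hqpos.le, ENNReal.coe_rpow_of_nonneg _ (by positivity),
        ← ENNReal.rpow_mul, one_div_mul_cancel hqpos.ne', ENNReal.rpow_one]
    _ ≤ κ * ‖lpIndicator hA h‖ₑ ^ p.toReal := by
      exact mul_le_mul_right
        (ENNReal.rpow_le_rpow_of_exponent_ge hle1 (ENNReal.toReal_mono hq hpq)) _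

end Lp

/-- Compactness degeneration: if `x ↦ G x x₀` is locally determined on `V`,
`G` is diagonal-differentiable at `(x₀,x₀)` with compact diagonal-derivative `L`, and
`F x := G x x` has relatively compact image on some ball around `x₀`, then `x ↦ G x x₀` is
Fréchet differentiable at `x₀` with derivative `0`; if moreover `x ↦ G x x₀` has maximal
domain `V`, then it is constant on `V` and `V` is the whole space. -/
theorem stmt17 {Ω : Type*} [MeasurableSpace Ω] {μ : Measure Ω}
    {E₁ E₂ : Type*} [NormedAddCommGroup E₁] [NormedSpace ℝ E₁] [CompleteSpace E₁]
    [NormedAddCommGroup E₂] [NormedSpace ℝ E₂] [CompleteSpace E₂]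
    (hatom : ∀ T : Set Ω, MeasurableSet T → 0 < μ T → μ T < ⊤ →
      ∃ D ⊆ T, MeasurableSet D ∧ 0 < μ D ∧ μ D < μ T)
    (p q : ℝ≥0∞) [Fact (1 ≤ p)] [Fact (1 ≤ q)] (hpq : p ≤ q) (hq : q ≠ ⊤)
    (U V : Set (Lp E₁ p μ)) (hUV : U ⊆ V)
    (x₀ : Lp E₁ p μ) (hx₀ : x₀ ∈ interior U)
    (G : Lp E₁ p μ → Lp E₁ p μ → Lp E₂ q μ)
    (hloc : ∀ D : Set Ω, MeasurableSet D → ∀ x ∈ V, ∀ x' ∈ V,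
      (∀ᵐ t ∂μ, t ∈ D → x t = x' t) →
      ∀ᵐ t ∂μ, t ∈ D → G x x₀ t = G x' x₀ t)
    (L : Lp E₁ p μ →L[ℝ] Lp E₂ q μ)
    (hdiag : ∀ ε > (0 : ℝ), ∃ δ > (0 : ℝ), ∀ h k : Lp E₁ p μ, ‖k‖ ≤ ‖h‖ → ‖h‖ < δ →
      ‖G (x₀ + k) (x₀ + h) - G (x₀ + k) x₀ - L h‖ ≤ ε * ‖h‖)
    (hcpt : ∃ r > (0 : ℝ),
      IsCompact (closure ((fun x => G x x) '' (Metric.ball x₀ r ∩ U))))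
    (hLcpt : IsCompactOperator (⇑L)) :
    HasFDerivAt (fun x => G x x₀) (0 : Lp E₁ p μ →L[ℝ] Lp E₂ q μ) x₀ ∧
    ((∀ x : Lp E₁ p μ,
        (∃ y : Lp E₂ q μ, ∀ T : Set Ω, MeasurableSet T → 0 < μ T →
          ∃ D ⊆ T, MeasurableSet D ∧ 0 < μ D ∧ ∃ xD ∈ V,
            (∀ᵐ t ∂μ, t ∈ D → xD t = x t) ∧ (∀ᵐ t ∂μ, t ∈ D → G xD x₀ t = y t)) →
        x ∈ V) →
      (∀ y₁ ∈ V, ∀ y₂ ∈ V, G y₁ x₀ = G y₂ x₀) ∧ V = Set.univ) := by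
  have hμ : NoFiniteAtoms μ := hatom
  have hp0 : p ≠ 0 := (zero_lt_one.trans_le (Fact.out : 1 ≤ p)).ne'
  have hp : p ≠ ⊤ := (hpq.trans_lt hq.lt_top).ne
  have hx₀U : x₀ ∈ U := interior_subset hx₀
  have hUnhds : U ∈ 𝓝 x₀ := mem_interior_iff_mem_nhds.mp hx₀
  have hVnhds : V ∈ 𝓝 x₀ := mem_of_superset hUnhds hUV
  obtain ⟨ρ, hρ, hball⟩ := Metric.mem_nhds_iff.mp hUnhds
  have hderiv : HasFDerivAt (fun x => G x x₀) (0 : Lp E₁ p μ →L[ℝ] Lp E₂ q μ) x₀ := by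
    obtain ⟨r, hr, hK⟩ := hcpt
    obtain ⟨K', hK', hLK'⟩ :=
      IsCompactOperator.image_closedBall_subset_compact (f := L.toLinearMap) hLcpt 1
    rw [hasFDerivAt_iff_isLittleO_nhds_zero, Asymptotics.isLittleO_iff]
    intro ε hε
    obtain ⟨δ, hδ, hδdiag⟩ := hdiag (ε / 8) (by positivity)
    refine Metric.eventually_nhds_iff.mpr
      ⟨min (min δ ρ) (min r 1), lt_min (lt_min hδ hρ) (lt_min hr one_pos), fun h hh => ?_⟩
    obtain ⟨⟨hhδ, hhρ⟩, hhr, hh1⟩ : (‖h‖ < δ ∧ ‖h‖ < ρ) ∧ ‖h‖ < r ∧ ‖h‖ < 1 := by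
      simpa using hh
    rw [_root_.zero_apply, sub_zero]
    rcases eq_or_ne h 0 with rfl | hne
    · simp
    have hη : 0 < ε / 8 * ‖h‖ := mul_pos (by positivity) (norm_pos_iff.mpr hne)
    obtain ⟨s, hs, hcover⟩ := Metric.totallyBounded_iff.mp 
      ((hK.prod hK').image continuous_sub).totallyBounded _ hη
    have hU : ∀ k : Lp E₁ p μ, ‖k‖ ≤ ‖h‖ → x₀ + k ∈ U := fun k hk =>
      hball (by simpa using hk.trans_lt hhρ)
    have hnet := norm_le_of_lpIndicator_net hμ hq (G (x₀ + h) x₀ - G x₀ x₀)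
      (hs.image fun z => z - G x₀ x₀) (r := 2 * (ε / 8 * ‖h‖)) ?_
    · linarith
    intro D hD
    have hk := norm_lpIndicator_le hD h
    rw [← map_add_lpIndicator_sub hloc (hUV hx₀U) (hUV (hU h le_rfl)) hD (hUV (hU _ hk))]
    generalize lpIndicator hD h = k at hk
    have hmem : G (x₀ + k) (x₀ + k) - L k ∈
        (fun z : Lp E₂ q μ × Lp E₂ q μ => z.1 - z.2) ''
          (closure ((fun x => G x x) '' (Metric.ball x₀ r ∩ U)) ×ˢ K') := by
      refine ⟨(G (x₀ + k) (x₀ + k), L k),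
        ⟨subset_closure ⟨x₀ + k, ⟨?_, hU k hk⟩, rfl⟩, hLK' ⟨k, ?_, rfl⟩⟩, rfl⟩
      · simpa using hk.trans_lt hhr
      · simpa using hk.trans hh1.le
    obtain ⟨z, hz, hdist⟩ := mem_iUnion₂.mp (hcover hmem)
    refine ⟨z - G x₀ x₀, mem_image_of_mem _ hz, ?_⟩
    have h1 := hδdiag k k le_rfl (hk.trans_lt hhδ)
    rw [Metric.mem_ball, dist_eq_norm] at hdist
    have h2 : ε / 8 * ‖k‖ ≤ ε / 8 * ‖h‖ := by gcongr
    calc ‖G (x₀ + k) x₀ - G x₀ x₀ - (z - G x₀ x₀)‖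
        = ‖(G (x₀ + k) (x₀ + k) - L k - z) -
            (G (x₀ + k) (x₀ + k) - G (x₀ + k) x₀ - L k)‖ := by congr 1; abel
      _ ≤ _ := norm_sub_le _ _
      _ ≤ 2 * (ε / 8 * ‖h‖) := by linarith
  refine ⟨hderiv, fun hmax => ?_⟩
  have hconst : ∀ x ∈ V, G x x₀ = G x₀ x₀ := fun x hx =>
    eq_of_hasFDerivAt_zero (H := fun x => G x x₀) hμ hpq hq hloc hVnhds hderiv hx
  refine ⟨fun y₁ h₁ y₂ h₂ => (hconst y₁ h₁).trans (hconst y₂ h₂).symm,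
    eq_univ_of_forall fun x => hmax x ⟨G x₀ x₀, fun T hT hT0 => ?_⟩⟩
  have := isFiniteMeasure_normRpowMeasure hp0 hp (x - x₀)
  obtain ⟨D, hDT, hD, hD0, hDle⟩ : ∃ D ⊆ T, MeasurableSet D ∧ 0 < μ D ∧
      normRpowMeasure (x - x₀) D ≤ ENNReal.ofReal (ρ / 2) ^ p.toReal := by
    rcases eq_or_ne (normRpowMeasure (x - x₀) T) 0 with h0 | h0
    · exact ⟨T, Subset.rfl, hT, hT0, h0.trans_le zero_le⟩
    · obtain ⟨D, hDT, hD, hD0, hDle⟩ :=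
        (hμ.normRpowMeasure hp0 hp (x - x₀)).exists_subset_pos_le hT (pos_iff_ne_zero.mpr h0)
          (ε := ENNReal.ofReal (ρ / 2) ^ p.toReal) (by simp [ENNReal.rpow_eq_zero_iff, hρ])
      refine ⟨D, hDT, hD, pos_iff_ne_zero.mpr fun hnull => hD0.ne' ?_, hDle⟩
      exact withDensity_absolutelyContinuous _ _ hnull
  have hnorm := norm_lpIndicator_le_of_normRpowMeasure_le hp0 hp hD (half_pos hρ).le hDle
  have hDV : x₀ + lpIndicator hD (x - x₀) ∈ V :=
    hUV (hball (by simpa using hnorm.trans_lt (half_lt_self hρ)))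
  refine ⟨D, hDT, hD, hD0, _, hDV, ?_, ?_⟩
  · filter_upwards [coeFn_lpIndicator hD (x - x₀), Lp.coeFn_sub x x₀,
      Lp.coeFn_add x₀ (lpIndicator hD (x - x₀))] with t h1 h2 h3 ht
    rw [h3, Pi.add_apply, h1, indicator_of_mem ht, h2, Pi.sub_apply, add_sub_cancel]
  · rw [hconst _ hDV]
    exact Eventually.of_forall fun _ _ => rfl
end
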